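/- Let G and G' be Gauss diagrams such that G' is obtained from G by exchanging the positions of a shell-pair and an adjacent endpoint of another chord (i.e., moving the four consecutive endpoints of a shell-pair of sign ε past one neighboring chord endpoint, preserving the signs and orientations of all chords). Then G and G' are related by a finite sequence of Ξ-moves and Reidemeister moves. -/

import Mathlib

/-!
Combinatorial Gauss diagrams.

A Gauss diagram is encoded as a list of chord endpoints read along the
oriented circle from a basepoint.  Each endpoint records the (natural number)
label of its chord, whether it is the terminal endpoint of the (oriented)
chord, and the sign of the chord (`true` = +1, `false` = -1).
Diagrams are considered up to rotation of the basepoint and relabeling of the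
chords; these renamings are included among the "Reidemeister" generators.
-/

structure Endpoint where
  label : ℕ
  isTerminal : Bool
  sign : Bool
deriving DecidableEq

namespace Gauss

/-- The sign (±1) of the chord through an endpoint. -/
def signValue (e : Endpoint) : ℤ := if e.sign then 1 else -1

/-- The sign assigned to an endpoint: `ε` at the terminal endpoint and `-ε`
at the initial endpoint of a chord of sign `ε`. -/
def endpointValue (e : Endpoint) : ℤ := if e.isTerminal then signValue e else -signValue e

/-- The list of chord labels of the endpoints of a word. -/
def labels (L : List Endpoint) : List ℕ := L.map Endpoint.label

/-- A word is a Gauss diagram when every chord label occurring in it occurs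
exactly twice, once as an initial and once as a terminal endpoint, with the
same sign at both occurrences. -/
def IsGaussDiagram (L : List Endpoint) : Prop :=
  ∀ e ∈ L, (L.filter (fun x => x.label == e.label)).length = 2 ∧
    ∃ e' ∈ L, e'.label = e.label ∧ e'.isTerminal = !e.isTerminal ∧ e'.sign = e.sign

/-- Rotate a word so that the first endpoint satisfying `p` comes first. -/
def rotateTo (L : List Endpoint) (p : Endpoint → Bool) : List Endpoint :=
  match L.findIdx? p with
  | some i => L.drop i ++ L.take i
  | none => L

/-- The index of the chord labeled `c`: the sum of the signs assigned to the
endpoints on the arc running from the initial endpoint of the chord to its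
terminal endpoint in the direction of the circle's orientation. -/
def chordIndex (L : List Endpoint) (c : ℕ) : ℤ :=
  ((((rotateTo L (fun e => e.label == c && !e.isTerminal)).drop 1).takeWhile
      (fun e => e.label != c)).map endpointValue).sum

/-- `Jn L n`: the sum of the signs of the chords of `L` of index `n`. -/
def Jn (L : List Endpoint) (n : ℤ) : ℤ :=
  ((L.filter (fun e => e.isTerminal && decide (chordIndex L e.label = n))).map signValue).sum

/-- The odd writhe: the sum of the signs of the chords of odd index,
i.e. `J = Σ_{n odd} J_n`. -/
def oddWrithe (L : List Endpoint) : ℤ :=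
  ((L.filter (fun e => e.isTerminal && decide (chordIndex L e.label % 2 ≠ 0))).map signValue).sum

/-- Moving the basepoint of the circle. -/
def rotateStep (L L' : List Endpoint) : Prop :=
  ∃ x xs, L = x :: xs ∧ L' = xs ++ [x]

/-- Injective relabeling of the chords. -/
def relabelStep (L L' : List Endpoint) : Prop :=
  ∃ f : ℕ → ℕ, Function.Injective f ∧
    L' = L.map (fun e => Endpoint.mk (f e.label) e.isTerminal e.sign)

/-- Reidemeister move I (removal direction): remove an isolated chord whose
two endpoints are adjacent (either orientation, either sign). -/
def reid1 (L L' : List Endpoint) : Prop :=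
  ∃ (A B : List Endpoint) (c : ℕ) (t s : Bool),
    c ∉ labels (A ++ B) ∧
    L = A ++ [Endpoint.mk c t s, Endpoint.mk c (!t) s] ++ B ∧
    L' = A ++ B

/-- Reidemeister move II (removal direction): remove two chords of opposite
signs whose initial endpoints are adjacent and whose terminal endpoints are
adjacent (in either of the two admissible orders). -/
def reid2 (L L' : List Endpoint) : Prop :=
  ∃ (A B C : List Endpoint) (c d : ℕ) (s crossed : Bool),
    c ≠ d ∧ c ∉ labels (A ++ B ++ C) ∧ d ∉ labels (A ++ B ++ C) ∧
    L = A ++ [Endpoint.mk c false s, Endpoint.mk d false (!s)] ++ B ++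
        (if crossed then [Endpoint.mk c true s, Endpoint.mk d true (!s)]
         else [Endpoint.mk d true (!s), Endpoint.mk c true s]) ++ C ∧
    L' = A ++ B ++ C

/-- Reidemeister move III (a standard variant; together with the moves I, II,
rotations and relabelings it generates all versions of the third move). -/
def reid3 (L L' : List Endpoint) : Prop :=
  ∃ (A B C D : List Endpoint) (a b c : ℕ) (s : Bool),
    a ≠ b ∧ b ≠ c ∧ a ≠ c ∧
    L = A ++ [Endpoint.mk b false s, Endpoint.mk a false s] ++ B ++
        [Endpoint.mk a true s, Endpoint.mk c false (!s)] ++ C ++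
        [Endpoint.mk b true s, Endpoint.mk c true (!s)] ++ D ∧
    L' = A ++ [Endpoint.mk a false s, Endpoint.mk b false s] ++ B ++
        [Endpoint.mk c false (!s), Endpoint.mk a true s] ++ C ++
        [Endpoint.mk c true (!s), Endpoint.mk b true s] ++ D

/-- A single Reidemeister generator (including diagram renamings). -/
def reidStep (L L' : List Endpoint) : Prop :=
  rotateStep L L' ∨ relabelStep L L' ∨ reid1 L L' ∨ reid2 L L' ∨ reid3 L L'

/-- A Ξ-move: exchange the first and third of three consecutive endpoints
belonging to three distinct chords, keeping all signs and orientations. -/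
def xiStep (L L' : List Endpoint) : Prop :=
  ∃ (A B : List Endpoint) (x y z : Endpoint),
    x.label ≠ y.label ∧ y.label ≠ z.label ∧ x.label ≠ z.label ∧
    L = A ++ [x, y, z] ++ B ∧
    L' = A ++ [z, y, x] ++ B

/-- A 2k-move (removal direction): remove `2k` chords `c 0, …, c (2k-1)`, all
of sign `s`, whose `p`-endpoints appear consecutively on one arc and whose
`q`-endpoints appear consecutively on a disjoint arc, the chord `c i` being
oriented from `p` to `q` for even `i` (the paper's odd `i`, 1-indexed) and
from `q` to `p` for odd `i`, so initial and terminal endpoints alternate. -/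
def move2k (k : ℕ) (L L' : List Endpoint) : Prop :=
  ∃ (A B C : List Endpoint) (c : ℕ → ℕ) (s : Bool),
    (∀ i < 2 * k, ∀ j < 2 * k, c i = c j → i = j) ∧
    (∀ i < 2 * k, c i ∉ labels (A ++ B ++ C)) ∧
    L = A ++ (List.range (2 * k)).map (fun i => Endpoint.mk (c i) (decide (i % 2 = 1)) s)
          ++ B ++
        (List.range (2 * k)).map (fun i => Endpoint.mk (c i) (decide (i % 2 = 0)) s)
          ++ C ∧
    L' = A ++ B ++ C

/-- A crossing change: reverse the sign and the orientation of one chord. -/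
def crossingChange (L L' : List Endpoint) : Prop :=
  ∃ c : ℕ,
    L' = L.map (fun e =>
      if e.label = c then Endpoint.mk e.label (!e.isTerminal) (!e.sign) else e)

/-- Finite sequences of moves from `r`, performed in either direction. -/
def Moves (r : List Endpoint → List Endpoint → Prop) :
    List Endpoint → List Endpoint → Prop :=
  Relation.ReflTransGen (fun L L' => r L L' ∨ r L' L)

/-- Related by Reidemeister moves: the two words represent the same virtual knot. -/
def ReidEquiv : List Endpoint → List Endpoint → Prop := Moves reidStep

/-- Related by a finite sequence of 2k-moves (and Reidemeister moves). -/
def Rel2k (k : ℕ) : List Endpoint → List Endpoint → Prop :=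
  Moves (fun L L' => reidStep L L' ∨ move2k k L L')

/-- Related by a finite sequence of Ξ-moves (and Reidemeister moves). -/
def RelXi : List Endpoint → List Endpoint → Prop :=
  Moves (fun L L' => reidStep L L' ∨ xiStep L L')

/-- Related by a finite sequence of 2k-moves and Ξ-moves (and Reidemeister moves). -/
def Rel2kXi (k : ℕ) : List Endpoint → List Endpoint → Prop :=
  Moves (fun L L' => reidStep L L' ∨ move2k k L L' ∨ xiStep L L')

/-- Related by a finite sequence of crossing changes and Ξ-moves
(and Reidemeister moves). -/
def RelCCXi : List Endpoint → List Endpoint → Prop :=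
  Moves (fun L L' => reidStep L L' ∨ crossingChange L L' ∨ xiStep L L')

/-- A shell-pair of sign `s`: two chords `c`, `d` of sign `s` whose four
endpoints are consecutive, interleaved as 1st-3rd and 2nd-4th
(with arbitrary orientations `t`, `u` of the two shells). -/
def shellPair (c d : ℕ) (t u s : Bool) : List Endpoint :=
  [Endpoint.mk c t s, Endpoint.mk d u s, Endpoint.mk c (!t) s, Endpoint.mk d (!u) s]

/-- The Gauss diagram `G(a)`: `|a|` consecutive shell-pairs of sign `+1` if
`a > 0` and of sign `-1` if `a < 0`; `G(0)` has no chords.  It represents the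
virtual knot `K(a)`. -/
def Gword (a : ℤ) : List Endpoint :=
  ((List.range a.natAbs).map
    (fun j => shellPair (2 * j) (2 * j + 1) false false (decide (0 < a)))).flatten

/-- `Rel2kCount k m G G'`: `G` and `G'` are related by a finite sequence of
Reidemeister moves and exactly `m` 2k-moves. -/
inductive Rel2kCount (k : ℕ) : ℕ → List Endpoint → List Endpoint → Prop
  | refl (L : List Endpoint) : Rel2kCount k 0 L L
  | reid {m : ℕ} {L L' L'' : List Endpoint} :
      reidStep L L' ∨ reidStep L' L →
      Rel2kCount k m L' L'' → Rel2kCount k m L L''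
  | move {m : ℕ} {L L' L'' : List Endpoint} :
      move2k k L L' ∨ move2k k L' L →
      Rel2kCount k m L' L'' → Rel2kCount k (m + 1) L L''

/-- The 2k-move distance: the minimal number of 2k-moves needed to relate the
two diagrams (together with Reidemeister moves). -/
noncomputable def dist2k (k : ℕ) (L L' : List Endpoint) : ℕ :=
  sInf {m | Rel2kCount k m L L'}

end Gauss

namespace Gauss

theorem RelXi.symm' {L L' : List Endpoint} (h : RelXi L L') : RelXi L' L := by
  induction h with
  | refl => exact Relation.ReflTransGen.refl
  | tail _ h ih => exact Relation.ReflTransGen.head h.symm ih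

theorem RelXi.trans' {L L' L'' : List Endpoint} (h : RelXi L L') (h' : RelXi L' L'') :
    RelXi L L'' := Relation.ReflTransGen.trans h h'

theorem RelXi.of_reid {L L' : List Endpoint} (h : reidStep L L') : RelXi L L' :=
  Relation.ReflTransGen.single (Or.inl (Or.inl h))

/-- The basepoint can be moved past a whole block. -/
theorem relXi_rotate (X Y : List Endpoint) : RelXi (X ++ Y) (Y ++ X) := by
  induction X generalizing Y with
  | nil => rw [List.append_nil]; exact Relation.ReflTransGen.refl
  | cons x X ih =>
    have h1 : RelXi (x :: X ++ Y) (X ++ (Y ++ [x])) :=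
      RelXi.of_reid (Or.inl ⟨x, X ++ Y, by simp, by simp⟩)
    have h2 := ih (Y ++ [x])
    have h3 := h1.trans' h2
    simpa using h3

theorem relXi_xi (A B : List Endpoint) (x y z : Endpoint)
    (h1 : x.label ≠ y.label) (h2 : y.label ≠ z.label) (h3 : x.label ≠ z.label) :
    RelXi (A ++ [x, y, z] ++ B) (A ++ [z, y, x] ++ B) :=
  Relation.ReflTransGen.single (Or.inl (Or.inr ⟨A, B, x, y, z, h1, h2, h3, rfl, rfl⟩))

theorem relXi_r1 (A B : List Endpoint) (c : ℕ) (t s : Bool) (h : c ∉ labels (A ++ B)) :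
    RelXi (A ++ [Endpoint.mk c t s, Endpoint.mk c (!t) s] ++ B) (A ++ B) :=
  RelXi.of_reid (Or.inr (Or.inr (Or.inl ⟨A, B, c, t, s, h, rfl, rfl⟩)))

/-- Second Reidemeister move with the terminal endpoints read first. -/
theorem relXi_r2 (A B C : List Endpoint) (f e : ℕ) (s : Bool) (hfe : f ≠ e)
    (hf : f ∉ labels (A ++ B ++ C)) (he : e ∉ labels (A ++ B ++ C)) :
    RelXi (A ++ [Endpoint.mk f true s, Endpoint.mk e true (!s)] ++ B ++
        [Endpoint.mk f false s, Endpoint.mk e false (!s)] ++ C) (A ++ B ++ C) := by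
  have h0 := relXi_rotate (A ++ [Endpoint.mk f true s, Endpoint.mk e true (!s)] ++ B)
    ([Endpoint.mk f false s, Endpoint.mk e false (!s)] ++ C)
  have h1 : RelXi ([] ++ [Endpoint.mk f false s, Endpoint.mk e false (!s)] ++ (C ++ A) ++
      [Endpoint.mk f true s, Endpoint.mk e true (!s)] ++ B) ([] ++ (C ++ A) ++ B) := by
    refine RelXi.of_reid (Or.inr (Or.inr (Or.inr (Or.inl
      ⟨[], C ++ A, B, f, e, s, true, hfe, ?_, ?_, by simp, rfl⟩))))
    · simp [labels] at hf ⊢; tauto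
    · simp [labels] at he ⊢; tauto
  have h2 := relXi_rotate C (A ++ B)
  simp only [List.append_assoc, List.nil_append] at h0 h1 h2 ⊢
  exact (h0.trans' h1).trans' h2

/-- Third Reidemeister move with the basepoint before the last block. -/
theorem relXi_r3 (A B C D : List Endpoint) (a b c : ℕ) (s : Bool)
    (hab : a ≠ b) (hbc : b ≠ c) (hac : a ≠ c) :
    RelXi (A ++ [Endpoint.mk b true s, Endpoint.mk c true (!s)] ++ B ++
        [Endpoint.mk b false s, Endpoint.mk a false s] ++ C ++
        [Endpoint.mk a true s, Endpoint.mk c false (!s)] ++ D)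
      (A ++ [Endpoint.mk c true (!s), Endpoint.mk b true s] ++ B ++
        [Endpoint.mk a false s, Endpoint.mk b false s] ++ C ++
        [Endpoint.mk c false (!s), Endpoint.mk a true s] ++ D) := by
  have h0 := relXi_rotate (A ++ [Endpoint.mk b true s, Endpoint.mk c true (!s)] ++ B)
    ([Endpoint.mk b false s, Endpoint.mk a false s] ++ C ++
        [Endpoint.mk a true s, Endpoint.mk c false (!s)] ++ D)
  have h2 := relXi_rotate ([Endpoint.mk a false s, Endpoint.mk b false s] ++ C ++
        [Endpoint.mk c false (!s), Endpoint.mk a true s] ++ D)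
        (A ++ [Endpoint.mk c true (!s), Endpoint.mk b true s] ++ B)
  have h1 : reidStep _ _ := Or.inr (Or.inr (Or.inr (Or.inr
      ⟨[], C, D ++ A, B, a, b, c, s, hab, hbc, hac, rfl, rfl⟩)))
  have h1 := RelXi.of_reid h1
  simp only [List.append_assoc, List.nil_append] at h0 h1 h2 ⊢
  exact (h0.trans' h1).trans' h2

/-- Swapping the two chords of a shell-pair of opposite orientations. -/
theorem relXi_swap (A B : List Endpoint) (c d : ℕ) (s : Bool) (hcd : c ≠ d) :
    RelXi (A ++ shellPair c d false true s ++ B) (A ++ shellPair d c true false s ++ B) := by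
  obtain ⟨e, he⟩ := Infinite.exists_notMem_finset
    (insert c (insert d (labels (A ++ B)).toFinset))
  obtain ⟨f, hf⟩ := Infinite.exists_notMem_finset
    (insert e (insert c (insert d (labels (A ++ B)).toFinset)))
  simp only [labels, List.map_append, Finset.mem_insert, List.mem_toFinset, List.mem_append,
    not_or] at he hf
  obtain ⟨hec, hed, heA, heB⟩ := he
  obtain ⟨hfe, hfc, hfd, hfA, hfB⟩ := hf
  -- add a kink `e`
  have s1 := (relXi_r1 A (shellPair c d false true s ++ B) e true (!s)
    (by simp [labels, shellPair]; simp at heA heB; tauto)).symm'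
  have s2 := relXi_xi (A ++ [⟨e, true, !s⟩]) ([⟨c, true, s⟩, ⟨d, false, s⟩] ++ B)
    ⟨e, false, !s⟩ ⟨c, false, s⟩ ⟨d, true, s⟩ hec hcd hed
  have s3 := relXi_xi (A ++ [⟨e, true, !s⟩, ⟨d, true, s⟩, ⟨c, false, s⟩]) B
    ⟨e, false, !s⟩ ⟨c, true, s⟩ ⟨d, false, s⟩ hec hcd hed
  -- add a kink `f`
  have s4 := (relXi_r1 A ([⟨e, true, !s⟩, ⟨d, true, s⟩, ⟨c, false, s⟩, ⟨d, false, s⟩,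
    ⟨c, true, s⟩, ⟨e, false, !s⟩] ++ B) f true s
    (by simp [labels]; simp at hfA hfB; tauto)).symm'
  have s5 := relXi_xi (A ++ [⟨f, true, s⟩]) ([⟨c, false, s⟩, ⟨d, false, s⟩,
    ⟨c, true, s⟩, ⟨e, false, !s⟩] ++ B)
    ⟨f, false, s⟩ ⟨e, true, !s⟩ ⟨d, true, s⟩ hfe hed hfd
  have s6 := relXi_xi (A ++ [⟨f, true, s⟩, ⟨d, true, s⟩, ⟨e, true, !s⟩])
    ([⟨c, true, s⟩, ⟨e, false, !s⟩] ++ B)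
    ⟨f, false, s⟩ ⟨c, false, s⟩ ⟨d, false, s⟩ hfc hcd hfd
  have s7 := relXi_r3 (A ++ [⟨f, true, s⟩]) [] [⟨f, false, s⟩] B c d e s hcd
    (Ne.symm hed) (Ne.symm hec)
  have s8 := relXi_r2 A [⟨d, true, s⟩, ⟨c, false, s⟩, ⟨d, false, s⟩] ([⟨c, true, s⟩] ++ B)
    f e s hfe (by simp [labels]; simp at hfA hfB; tauto)
    (by simp [labels]; simp at heA heB; tauto)
  simp only [shellPair, List.append_assoc, List.cons_append, List.nil_append,
    Bool.not_true, Bool.not_false] at s1 s2 s3 s4 s5 s6 s7 s8 ⊢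
  exact s1.trans' (s2.trans' (s3.trans' (s4.trans' (s5.trans' (s6.trans' (s7.trans' s8))))))

/-- Relabeling exchanges the chords of a shell-pair with parallel orientations. -/
theorem relXi_relabel (A B : List Endpoint) (c d : ℕ) (t s : Bool)
    (hc : c ∉ labels (A ++ B)) (hd : d ∉ labels (A ++ B)) :
    RelXi (A ++ shellPair d c t t s ++ B) (A ++ shellPair c d t t s ++ B) := by
  refine RelXi.of_reid (Or.inr (Or.inl ⟨Equiv.swap c d, (Equiv.swap c d).injective, ?_⟩))
  have key : ∀ L : List Endpoint, c ∉ labels L → d ∉ labels L →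
      L.map (fun e => Endpoint.mk (Equiv.swap c d e.label) e.isTerminal e.sign) = L := by
    intro L h1 h2
    conv_rhs => rw [← List.map_id L]
    refine List.map_congr_left fun e he => ?_
    have h1 : e.label ≠ c := fun h => h1 (h ▸ List.mem_map_of_mem he)
    have h2 : e.label ≠ d := fun h => h2 (h ▸ List.mem_map_of_mem he)
    simp [Equiv.swap_apply_of_ne_of_ne h1 h2]
  simp only [labels, List.map_append, List.mem_append, not_or] at hc hd
  rw [List.map_append, List.map_append, key A hc.1 hd.1, key B hc.2 hd.2]
  simp [shellPair]

theorem relXi_swap_all (A B : List Endpoint) (c d : ℕ) (t u s : Bool) (hcd : c ≠ d)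
    (hc : c ∉ labels (A ++ B)) (hd : d ∉ labels (A ++ B)) :
    RelXi (A ++ shellPair d c u t s ++ B) (A ++ shellPair c d t u s ++ B) := by
  cases t <;> cases u
  · exact relXi_relabel A B c d _ s hc hd
  · exact (relXi_swap A B c d s hcd).symm'
  · exact relXi_swap A B d c s hcd.symm
  · exact relXi_relabel A B c d _ s hc hd

end Gauss

open Gauss in
/-- exchanging the positions of a shell-pair and an adjacent
endpoint of another chord is realized by Ξ-moves and Reidemeister moves. -/
theorem relXi_of_shellPair_slide
    (G G' A B : List Endpoint) (c d : ℕ) (t u s : Bool) (x : Endpoint)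
    (hcd : c ≠ d) (hxc : x.label ≠ c) (hxd : x.label ≠ d)
    (hG : G = A ++ shellPair c d t u s ++ [x] ++ B)
    (hG' : G' = A ++ [x] ++ shellPair c d t u s ++ B)
    (hvalid : IsGaussDiagram G) :
    RelXi G G' := by
  have hc : c ∉ labels ((A ++ [x]) ++ B) := by
    have h := (hvalid ⟨c, t, s⟩ (by simp [hG, shellPair])).1
    subst hG
    simp [shellPair, hcd.symm, hxc] at h
    simp only [labels, List.mem_map, List.mem_append, List.mem_singleton]
    rintro ⟨e, (he | rfl) | he, rfl⟩
    · have : e ∈ A.filter (fun y => y.label == e.label) := by simp [he]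
      have := List.length_pos_of_mem this
      omega
    · exact hxc rfl
    · have : e ∈ B.filter (fun y => y.label == e.label) := by simp [he]
      have := List.length_pos_of_mem this
      omega
  have hd : d ∉ labels ((A ++ [x]) ++ B) := by
    have h := (hvalid ⟨d, u, s⟩ (by simp [hG, shellPair])).1
    subst hG
    simp [shellPair, hcd, hxd] at h
    simp only [labels, List.mem_map, List.mem_append, List.mem_singleton]
    rintro ⟨e, (he | rfl) | he, rfl⟩
    · have : e ∈ A.filter (fun y => y.label == e.label) := by simp [he]
      have := List.length_pos_of_mem this
      omega
    · exact hxd rfl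
    · have : e ∈ B.filter (fun y => y.label == e.label) := by simp [he]
      have := List.length_pos_of_mem this
      omega
  have s1 := relXi_xi (A ++ [⟨c, t, s⟩, ⟨d, u, s⟩]) B ⟨c, !t, s⟩ ⟨d, !u, s⟩ x
    hcd hxd.symm hxc.symm
  have s2 := relXi_xi A ([⟨d, !u, s⟩, ⟨c, !t, s⟩] ++ B) ⟨c, t, s⟩ ⟨d, u, s⟩ x
    hcd hxd.symm hxc.symm
  have s3 := relXi_swap_all (A ++ [x]) B c d t u s hcd hc hd
  subst hG hG'
  simp only [shellPair, List.append_assoc, List.cons_append, List.nil_append] at s1 s2 s3 ⊢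
  exact s1.trans' (s2.trans' s3)
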